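/- For every A ∈ SL(2,ℂ), the matrix T = Φ(A) lies in SO⁺(3,1): it satisfies det(T) = 1 and T⁰₀ > 0. In particular T⁰₀ = |a⁰|² + |a¹|² + |a²|² + |a³|², where A = ∑_{i=0}^{3} aⁱσᵢ. -/

import Mathlib

open Matrix Complex Finset

/-- The Pauli matrices σ₀, σ₁, σ₂, σ₃. -/
noncomputable def σm : Fin 4 → Matrix (Fin 2) (Fin 2) ℂ :=
  ![!![1, 0; 0, 1], !![0, 1; 1, 0], !![0, -I; I, 0], !![1, 0; 0, -1]]

/-- The totally antisymmetric symbol with ε₁₂₃ = 1 (on indices in {1,2,3} ⊂ {0,1,2,3}). -/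
noncomputable def eps (i j k : Fin 4) : ℂ :=
  if (i, j, k) = (1, 2, 3) ∨ (i, j, k) = (2, 3, 1) ∨ (i, j, k) = (3, 1, 2) then 1
  else if (i, j, k) = (1, 3, 2) ∨ (i, j, k) = (3, 2, 1) ∨ (i, j, k) = (2, 1, 3) then -1
  else 0

/-- Ψ : ℝ⁴ → M₂(ℂ), Ψ(x) = ∑ xⁱ σᵢ. -/
noncomputable def Ψ (x : Fin 4 → ℝ) : Matrix (Fin 2) (Fin 2) ℂ :=
  ∑ i, (x i : ℂ) • σm i

/-- The conjugated matrix A' = tr(A)·σ₀ − A (i.e. a⁰σ₀ − a¹σ₁ − a²σ₂ − a³σ₃). -/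
noncomputable def matConj (A : Matrix (Fin 2) (Fin 2) ℂ) : Matrix (Fin 2) (Fin 2) ℂ :=
  A.trace • (1 : Matrix (Fin 2) (Fin 2) ℂ) - A

/-- The inverse of Ψ (on Hermitian matrices): xⁱ = Re((1/2)·tr(σᵢ M)). -/
noncomputable def ΨInv (M : Matrix (Fin 2) (Fin 2) ℂ) : Fin 4 → ℝ :=
  fun i => ((1 / 2 : ℂ) * (σm i * M).trace).re

/-- Φ(A)(x) = Ψ⁻¹(A Ψ(x) A†). -/
noncomputable def Φ (A : Matrix (Fin 2) (Fin 2) ℂ) (x : Fin 4 → ℝ) : Fin 4 → ℝ :=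
  ΨInv (A * Ψ x * Aᴴ)

/-- The Minkowski norm ‖x‖² = (x⁰)² − (x¹)² − (x²)² − (x³)². -/
def mink (x : Fin 4 → ℝ) : ℝ := x 0 ^ 2 - x 1 ^ 2 - x 2 ^ 2 - x 3 ^ 2

/-- The Minkowski metric g = diag(1,−1,−1,−1). -/
def gM : Matrix (Fin 4) (Fin 4) ℝ := Matrix.diagonal ![1, -1, -1, -1]

/-- τ₍ᵢ₎(T) = ∑_{j,k} Tʲₖ σᵢ' σⱼ σᵢ σₖ. -/
noncomputable def τm (T : Matrix (Fin 4) (Fin 4) ℝ) (i : Fin 4) : Matrix (Fin 2) (Fin 2) ℂ :=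
  ∑ j, ∑ k, (T j k : ℂ) • (matConj (σm i) * σm j * σm i * σm k)

/-- The ℂ-linear extension of Ψ⁻¹: component i is (1/2)·tr(σᵢ M). -/
noncomputable def ΨInvC (M : Matrix (Fin 2) (Fin 2) ℂ) : Fin 4 → ℂ :=
  fun i => (1 / 2 : ℂ) * (σm i * M).trace

theorem sigma_isHermitian (i : Fin 4) : (σm i)ᴴ = σm i := by
  fin_cases i <;> ext p q <;> fin_cases p <;> fin_cases q <;> simp [σm]

theorem Psi_single (j : Fin 4) : Ψ (Pi.single j 1) = σm j := by
  rw [Ψ, Finset.sum_eq_single j]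
  · simp
  · intro i _ hi
    simp [Pi.single_eq_of_ne hi]
  · simp

theorem Psi_isHermitian (x : Fin 4 → ℝ) : (Ψ x)ᴴ = Ψ x := by
  simp [Ψ, conjTranspose_sum, conjTranspose_smul, sigma_isHermitian]

theorem det_Psi (x : Fin 4 → ℝ) : (Ψ x).det = (mink x : ℂ) := by
  simp [Ψ, σm, mink, Fin.sum_univ_four, det_fin_two]
  linear_combination (x 2 : ℂ) ^ 2 * I_sq

theorem Psi_PsiInv {M : Matrix (Fin 2) (Fin 2) ℂ} (hM : Mᴴ = M) : Ψ (ΨInv M) = M := by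
  have h (p q : Fin 2) : star (M q p) = M p q := congrFun (congrFun hM p) q
  have h00 := Complex.ext_iff.mp (h 0 0)
  have h01 := Complex.ext_iff.mp (h 0 1)
  have h11 := Complex.ext_iff.mp (h 1 1)
  simp at h00 h01 h11
  ext p q
  fin_cases p <;> fin_cases q <;> apply Complex.ext <;>
    simp [Ψ, ΨInv, σm, Fin.sum_univ_four, trace_fin_two, vecMul, vecHead, vecTail] <;>
    linarith

theorem mink_Phi {A : Matrix (Fin 2) (Fin 2) ℂ} (hA : A.det = 1) (x : Fin 4 → ℝ) :
    mink (Φ A x) = mink x := by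
  have hM : (A * Ψ x * Aᴴ)ᴴ = A * Ψ x * Aᴴ := by
    simp [conjTranspose_mul, Psi_isHermitian, Matrix.mul_assoc]
  have h : ((mink (Φ A x) : ℝ) : ℂ) = mink x := by
    rw [← det_Psi, ← det_Psi, Φ, Psi_PsiInv hM, det_mul, det_mul, det_conjTranspose, hA]
    simp
  exact_mod_cast h

/-- A linear map preserving the Minkowski norm preserves the Minkowski metric. -/
theorem transpose_mul_gM_mul {T : Matrix (Fin 4) (Fin 4) ℝ}
    (hT : ∀ x, mink (T *ᵥ x) = mink x) : Tᵀ * gM * T = gM := by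
  have polar (x y : Fin 4 → ℝ) :
      x ⬝ᵥ (gM *ᵥ y) = (mink (x + y) - mink x - mink y) / 2 := by
    simp [gM, mink, dotProduct, mulVec_diagonal, Fin.sum_univ_four]
    ring
  ext i j
  have h : (T *ᵥ Pi.single i 1) ⬝ᵥ (gM *ᵥ (T *ᵥ Pi.single j 1)) =
      Pi.single i 1 ⬝ᵥ (gM *ᵥ Pi.single j 1) := by
    rw [polar, polar, ← mulVec_add, hT, hT, hT]
  have entry (M : Matrix (Fin 4) (Fin 4) ℝ) :
      Pi.single i 1 ⬝ᵥ (M *ᵥ Pi.single j 1) = M i j := by simp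
  rw [← entry (Tᵀ * gM * T), ← entry gM, ← h, ← mulVec_mulVec, ← mulVec_mulVec, dotProduct_mulVec,
    vecMul_transpose]

/-- The matrix coefficients of `Φ A` are real, so the real part in `ΨInv` may be dropped. -/
theorem ofReal_Phi_single (A : Matrix (Fin 2) (Fin 2) ℂ) (i j : Fin 4) :
    (Φ A (Pi.single j 1) i : ℂ) = 1 / 2 * (σm i * (A * σm j * Aᴴ)).trace := by
  rw [Φ, ΨInv, Psi_single, ← Complex.conj_eq_iff_re, map_mul, starRingEnd_apply,
    starRingEnd_apply, ← trace_conjTranspose, conjTranspose_mul, trace_mul_comm]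
  simp [conjTranspose_mul, sigma_isHermitian, Matrix.mul_assoc]

/-- The Pauli matrices as the columns of a change of basis. -/
noncomputable def pauliBasis : Matrix (Fin 2 × Fin 2) (Fin 4) ℂ :=
  of fun p i => σm i p.1 p.2

/-- The inverse of `pauliBasis`. -/
noncomputable def pauliBasisInv : Matrix (Fin 4) (Fin 2 × Fin 2) ℂ :=
  of fun i p => 1 / 2 * σm i p.2 p.1

theorem pauliBasisInv_mul : pauliBasisInv * pauliBasis = 1 := by
  ext i j
  fin_cases i <;> fin_cases j <;>
    norm_num [pauliBasis, pauliBasisInv, mul_apply, Fintype.sum_prod_type, σm, mul_assoc]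

theorem mul_pauliBasisInv : pauliBasis * pauliBasisInv = 1 :=
  (mul_eq_one_comm_of_equiv finProdFinEquiv.symm).mp pauliBasisInv_mul

open scoped Kronecker in
theorem det_Phi {A : Matrix (Fin 2) (Fin 2) ℂ} (hA : A.det = 1) :
    (of fun i j => Φ A (Pi.single j 1) i).det = 1 := by
  have h : (of fun i j => Φ A (Pi.single j 1) i).map ofRealHom =
      pauliBasisInv * (A ⊗ₖ A.map star) * pauliBasis := by
    ext i j
    rw [map_apply, of_apply, ofRealHom_eq_coe, ofReal_Phi_single]
    simp [pauliBasis, pauliBasisInv, mul_apply, Fintype.sum_prod_type, trace_fin_two,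
      conjTranspose_apply]
    ring
  have hstar : (A.map star).det = 1 := by
    rw [← det_transpose, ← transpose_map, ← conjTranspose, det_conjTranspose, hA, star_one]
  have hdet : ofRealHom (of fun i j => Φ A (Pi.single j 1) i).det = 1 := by
    rw [RingHom.map_det, RingHom.mapMatrix_apply, h,
      det_conj_of_mul_eq_one pauliBasisInv_mul mul_pauliBasisInv, det_kronecker, hA, hstar]
    simp
  exact ofRealHom.injective (hdet.trans (map_one _).symm)

theorem Phi_single_zero_zero (a : Fin 4 → ℂ) :
    Φ (∑ i, a i • σm i) (Pi.single 0 1) 0 =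
      ‖a 0‖ ^ 2 + ‖a 1‖ ^ 2 + ‖a 2‖ ^ 2 + ‖a 3‖ ^ 2 := by
  simp only [← normSq_eq_norm_sq, normSq_apply]
  have hσ : σm 0 = 1 := by simp [σm, one_fin_two]
  rw [Φ, Psi_single, ΨInv, hσ, Matrix.one_mul, Matrix.mul_one]
  simp only [trace_fin_two, mul_apply, Fin.sum_univ_two, conjTranspose_apply]
  simp [σm, Fin.sum_univ_four]
  ring

/-- For A ∈ SL(2,ℂ), T = Φ(A) lies in SO⁺(3,1): Tᵗ g T = g, det(T) = 1 and T⁰₀ > 0;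
in particular T⁰₀ = |a⁰|² + |a¹|² + |a²|² + |a³|². -/
theorem Phi_mem_restricted_lorentz (a : Fin 4 → ℂ) (A : Matrix (Fin 2) (Fin 2) ℂ)
    (hAa : A = ∑ i, a i • σm i) (hA : A.det = 1)
    (T : Matrix (Fin 4) (Fin 4) ℝ)
    (hT : ∀ (x : Fin 4 → ℝ) (i : Fin 4), Φ A x i = ∑ j, T i j * x j) :
    Tᵀ * gM * T = gM ∧ T.det = 1 ∧ 0 < T 0 0 ∧
      T 0 0 = ‖a 0‖ ^ 2 + ‖a 1‖ ^ 2 + ‖a 2‖ ^ 2 + ‖a 3‖ ^ 2 := by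
  have hmul (x : Fin 4 → ℝ) : T *ᵥ x = Φ A x := funext fun i => (hT x i).symm
  have hentry : T = of fun i j => Φ A (Pi.single j 1) i := by
    ext i j
    simp [← hmul]
  have h00 : T 0 0 = ‖a 0‖ ^ 2 + ‖a 1‖ ^ 2 + ‖a 2‖ ^ 2 + ‖a 3‖ ^ 2 := by
    rw [hentry, of_apply, hAa, Phi_single_zero_zero]
  refine ⟨transpose_mul_gM_mul fun x => ?_, ?_, ?_, h00⟩
  · rw [hmul, mink_Phi hA]
  · rw [hentry, det_Phi hA]
  · rw [h00, ← Fin.sum_univ_four fun i => ‖a i‖ ^ 2]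
    have ha : ∃ i, a i ≠ 0 := by
      by_contra! h
      simp [hAa, h] at hA
    obtain ⟨i, hi⟩ := ha
    exact Finset.sum_pos' (fun _ _ => by positivity) ⟨i, mem_univ i, by positivity⟩
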